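/- If Q is a uniquely 2-divisible commutative A-loop and the Bruck loop operation x∘y = (x^{-1}\(x y^2))^{1/2} is commutative, then (Q,∘) is isomorphic to Q (via the squaring map). -/

import Mathlib

/-- A commutative loop: commutative binary operation with two-sided identity
and a left division making all translations bijective. -/
class CommLoop (Q : Type*) extends Mul Q, One Q where
  mul_comm : ∀ x y : Q, x * y = y * x
  one_mul : ∀ x : Q, 1 * x = x
  mul_one : ∀ x : Q, x * 1 = x
  ldiv : Q → Q → Q
  mul_ldiv : ∀ x y : Q, x * ldiv x y = y
  ldiv_mul : ∀ x y : Q, ldiv x (x * y) = y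

namespace CommLoop

variable {Q : Type*} [CommLoop Q]

/-- The inverse `x⁻¹ = x \ 1`. -/
def inv (x : Q) : Q := ldiv x 1

/-- The inner mapping `L_{x,y} = L_x L_y L_{yx}⁻¹` (permutations acting on the right):
`z L_{x,y} = (yx) \ (y(xz))`. -/
def inn (x y z : Q) : Q := ldiv (y * x) (y * (x * z))

/-- Natural powers: `x^n = 1 L_x^n`. -/
def npow (x : Q) (n : ℕ) : Q := (fun y => x * y)^[n] 1

/-- Integer powers: `x^n = 1 L_x^n`. -/
def zpow (x : Q) : ℤ → Q
  | Int.ofNat n => npow x n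
  | Int.negSucc n => (fun y => ldiv x y)^[n + 1] 1

/-- A commutative A-loop: every inner mapping `L_{x,y}` is an automorphism. -/
class IsALoop (Q : Type*) [CommLoop Q] : Prop where
  inn_mul : ∀ x y u v : Q, inn x y (u * v) = inn x y u * inn x y v

/-- The left translation `L_x` as a permutation of `Q`. -/
def Le (x : Q) : Equiv.Perm Q :=
  ⟨fun y => x * y, fun y => ldiv x y, fun y => ldiv_mul x y, fun y => mul_ldiv x y⟩

/-- The permutation `P_x = L_x L_{x⁻¹}⁻¹`. -/
def Pe (x : Q) : Equiv.Perm Q := (Le x).trans (Le (inv x)).symm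

end CommLoop

namespace CommLoop

section Basic

variable {Q : Type*} [CommLoop Q]

theorem mul_left_cancel' {x y z : Q} (h : x * y = x * z) : y = z := by
  rw [← ldiv_mul x y, h, ldiv_mul]

theorem ldiv_eq_of_eq_mul {x y z : Q} (h : y = x * z) : ldiv x y = z := by
  rw [h, ldiv_mul]

theorem mul_inv (x : Q) : x * inv x = 1 := mul_ldiv x 1

theorem inv_eq_of_mul_eq_one {x y : Q} (h : x * y = 1) : inv x = y :=
  ldiv_eq_of_eq_mul h.symm

theorem inv_inv (x : Q) : inv (inv x) = x :=
  inv_eq_of_mul_eq_one ((mul_comm _ _).trans (mul_inv x))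

theorem mul_inn (x y z : Q) : (y * x) * inn x y z = y * (x * z) := mul_ldiv _ _

theorem inn_one (x y : Q) : inn x y 1 = 1 :=
  ldiv_eq_of_eq_mul (by rw [mul_one, mul_one])

theorem inn_right_self (x y : Q) : inn x y y = y :=
  ldiv_eq_of_eq_mul (by rw [mul_comm x y, mul_comm])

/-- The permutation `P_x` as a function: `z P_x = x⁻¹ \ (x z)`. -/
theorem Pe_apply (x z : Q) : Pe x z = ldiv (inv x) (x * z) := rfl

theorem Pe_inv_Pe (x z : Q) : Pe (inv x) (Pe x z) = z := by
  rw [Pe_apply, Pe_apply, mul_ldiv, inv_inv, ldiv_mul]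

theorem Pe_Pe_inv (x z : Q) : Pe x (Pe (inv x) z) = z := by
  simpa only [inv_inv] using Pe_inv_Pe (inv x) z

end Basic

section ALoop

variable {Q : Type*} [CommLoop Q] [IsALoop Q]

theorem inn_inv (x y z : Q) : inn x y (inv z) = inv (inn x y z) :=
  (inv_eq_of_mul_eq_one (by rw [← IsALoop.inn_mul, mul_inv, inn_one])).symm

/-- `L_x` and `L_{x⁻¹}` commute, because the automorphism `L_{x⁻¹,x}` fixes `x`. -/
theorem mul_inv_mul (x z : Q) : x * (inv x * z) = inv x * (x * z) := by
  have e (z : Q) : inn (inv x) x z = x * (inv x * z) := by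
    rw [← mul_inn, mul_inv, one_mul]
  apply mul_left_cancel' (x := x)
  rw [← e, ← e, IsALoop.inn_mul, inn_right_self]

theorem inv_mul_mul_self (x : Q) : inv x * (x * x) = x := by
  rw [← mul_inv_mul, mul_comm (inv x) x, mul_inv, mul_one]

/-- The automorphic inverse property. -/
theorem inv_mul (x y : Q) : inv (x * y) = inv x * inv y := by
  have h (p y : Q) : inv (ldiv (p * y) p) * inv (p * y) = inv p := by
    have h₁ : inn y p (inv y) = ldiv (p * y) p := by
      rw [inn, mul_inv, mul_one]
    have h₂ : inn y p (ldiv y (inv p)) = inv (p * y) := by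
      rw [inn, mul_ldiv, mul_inv, inv]
    rw [← h₁, inn_inv, inv_inv, ← h₂, ← IsALoop.inn_mul, mul_ldiv, inn_inv, inn_right_self]
  have := h (x * y) (ldiv (x * y) x)
  rw [mul_ldiv, ldiv_mul] at this
  rw [← this, mul_comm]

theorem inv_ldiv (x y : Q) : inv (ldiv x y) = ldiv (inv x) (inv y) :=
  (ldiv_eq_of_eq_mul (by rw [← inv_mul, mul_ldiv])).symm

theorem inn_inv_inv (x y z : Q) : inn (inv x) (inv y) z = inn x y z := by
  rw [← inv_inv (inn x y z), ← inn_inv]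
  simp only [inn, inv_ldiv, inv_mul, inv_inv]

theorem inv_Pe (x z : Q) : inv (Pe x z) = Pe (inv x) (inv z) := by
  simp only [Pe_apply, inv_ldiv, inv_mul]

theorem Pe_Pe (x z : Q) : Pe x (Pe x z) = Pe (x * x) z := by
  have hx (t : Q) : inv x * Pe x t = x * t := mul_ldiv _ _
  have hfix : inn x x (inv (x * x)) = inv (x * x) := by
    rw [inn_inv, IsALoop.inn_mul, inn_right_self]
  apply mul_left_cancel' (x := inv (x * x))
  rw [Pe_apply (x * x), mul_ldiv]
  have key : inn x x (inv (x * x) * Pe x (Pe x z)) = inn x x ((x * x) * z) := by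
    rw [IsALoop.inn_mul, IsALoop.inn_mul, hfix, IsALoop.inn_mul, inn_right_self, mul_inn,
      ← inn_inv_inv, inv_mul, mul_inn, hx, ← mul_inv_mul, hx]
  have := congrArg (fun t => (x * x) * t) key
  simp only [mul_inn] at this
  exact mul_left_cancel' (mul_left_cancel' this)

theorem Pe_inv_mul (x z : Q) : Pe (inv x) (x * z) = inv x * z := by
  rw [Pe_apply, inv_inv, ← mul_inv_mul, ldiv_mul]

/-- In a commutative Bruck loop `(Q,∘)`, `(w ∘ u) ∘ (w ∘ u⁻¹) = w²`. -/
theorem op_op_op_inv (hdiv : Function.Bijective (fun x : Q => x * x)) {op : Q → Q → Q}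
    (hop : ∀ x y : Q, op x y * op x y = Pe x (y * y))
    (hcomm : ∀ x y : Q, op x y = op y x) (w u : Q) :
    op (op w u) (op w (inv u)) = w * w := by
  have ext {a b : Q} (h : a * a = b * b) : a = b := hdiv.1 h
  have op_inv (x y : Q) : inv (op x y) = op (inv x) (inv y) :=
    ext (by rw [← inv_mul, hop, hop, inv_Pe, inv_mul])
  have inv_op (x y : Q) : op (inv x) (op x y) = y :=
    ext (by rw [hop, hop, Pe_inv_Pe])
  have op_op (x y : Q) : op x (op x y) = op (x * x) y :=
    ext (by rw [hop, hop, hop, Pe_Pe])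
  have h : op w (inv u) = op (w * w) (inv (op w u)) := by
    have := inv_op (inv w) (inv u)
    rw [inv_inv] at this
    rw [← op_op, op_inv, this]
  have := inv_op (inv (op w u)) (w * w)
  rwa [inv_inv, hcomm _ (w * w), ← h] at this

/-- If the Bruck loop operation `∘` is commutative, squaring is a homomorphism from `(Q,∘)`. -/
theorem op_mul_op_self (hdiv : Function.Bijective (fun x : Q => x * x)) {op : Q → Q → Q}
    (hop : ∀ x y : Q, op x y * op x y = Pe x (y * y))
    (hcomm : ∀ x y : Q, op x y = op y x) (x y : Q) :
    op x y * op x y = (x * x) * (y * y) := by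
  have ext {a b : Q} (h : a * a = b * b) : a = b := hdiv.1 h
  obtain ⟨r, hr⟩ := hdiv.2 (Pe (inv x) ((x * x) * (y * y)))
  obtain ⟨s, hs⟩ := hdiv.2 (Pe (inv y) ((x * x) * (y * y)))
  dsimp only at hr hs
  have h₁ : op r x = op y s := ext <| by
    rw [hcomm, hop, hop, hr, hs, Pe_Pe_inv, Pe_Pe_inv]
  have h₂ : op r (inv x) = op y (inv s) := ext <| by
    rw [hcomm, hop, hop, hr, Pe_Pe, ← inv_mul, Pe_inv_mul, ← inv_mul s, hs, ← inv_inv y,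
      ← inv_Pe, inv_inv, Pe_Pe, ← inv_mul, mul_comm (x * x), Pe_inv_mul, inv_mul (inv (y * y)),
      inv_inv, mul_comm]
  have h : r * r = y * y := by
    rw [← op_op_op_inv hdiv hop hcomm r x, h₁, h₂, op_op_op_inv hdiv hop hcomm]
  rw [hop, ← Pe_Pe_inv x (x * x * (y * y)), ← hr, h]

end ALoop

end CommLoop

open CommLoop in
/-- If `Q` is a uniquely 2-divisible commutative A-loop and the Bruck loop operation
`x∘y = (x⁻¹ \ (x y²))^{1/2}` is commutative, then the squaring map is an isomorphism
from `(Q,∘)` onto `Q`. -/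
theorem stmt13 {Q : Type*} [CommLoop Q] [IsALoop Q]
    (hdiv : Function.Bijective (fun x : Q => x * x))
    (op : Q → Q → Q)
    (hop : ∀ x y : Q, op x y * op x y = ldiv (inv x) (x * (y * y)))
    (hcomm : ∀ x y : Q, op x y = op y x) :
    ∀ x y : Q, op x y * op x y = (x * x) * (y * y) := by
  exact op_mul_op_self hdiv hop hcomm
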